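/- arXiv:1205.6971 — 2 statements merged into one kernel-verified Lean document; each statement's English description precedes it below -/
import Mathlib

section
/- Let $I$ be a monomial ideal in $S=\mathbb{K}[x_1,\dots,x_n]$. Then the eventual (stable) set of associated primes of the integral closures of powers of $I$ is contained in the eventual set of associated primes of the powers of $I$: if $N_1, N_2$ are such that $\mathrm{Ass}(S/I^{N_1+k})=\mathrm{Ass}(S/I^{N_1})$ and $\mathrm{Ass}(S/\overline{I^{N_2+k}})=\mathrm{Ass}(S/\overline{I^{N_2}})$ for all $k\geq 1$, then $\mathrm{Ass}(S/\overline{I^{N_2}})\subseteq \mathrm{Ass}(S/I^{N_1})$. -/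
open MvPolynomial

noncomputable section

/-- `I` is a monomial ideal: it is generated by a set of monomials. -/
def IsMonomialIdeal {K : Type*} [Field K] {n : ℕ} (I : Ideal (MvPolynomial (Fin n) K)) : Prop :=
  ∃ A : Set (Fin n →₀ ℕ),
    I = Ideal.span ((fun d => (monomial d (1 : K) : MvPolynomial (Fin n) K)) '' A)

/-- The integral closure of a monomial ideal `I`: the ideal generated by all monomials `u`
such that `u ^ m ∈ I ^ m` for some `m ≥ 1`. -/
def intCl {K : Type*} [Field K] {n : ℕ} (I : Ideal (MvPolynomial (Fin n) K)) :
    Ideal (MvPolynomial (Fin n) K) :=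
  Ideal.span {u | (∃ d : Fin n →₀ ℕ, u = monomial d (1 : K)) ∧ ∃ m : ℕ, 1 ≤ m ∧ u ^ m ∈ I ^ m}

/-- The set of exponent vectors of monomials belonging to `I`. -/
def monomialSet {K : Type*} [Field K] {n : ℕ} (I : Ideal (MvPolynomial (Fin n) K)) :
    Set (Fin n →₀ ℕ) :=
  {d | (monomial d (1 : K) : MvPolynomial (Fin n) K) ∈ I}

/-- The set of exponent vectors of the monomials in the Stanley space `a·K[Z]`. -/
def stanleySpace {n : ℕ} (a : Fin n →₀ ℕ) (Z : Finset (Fin n)) : Set (Fin n →₀ ℕ) :=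
  {b | (∀ i, a i ≤ b i) ∧ ∀ i ∉ Z, b i = a i}

/-- `D` is a Stanley decomposition of the set of monomials `M`. -/
def IsStanleyDecomp {n : ℕ} (M : Set (Fin n →₀ ℕ))
    (D : Finset ((Fin n →₀ ℕ) × Finset (Fin n))) : Prop :=
  (∀ p ∈ D, stanleySpace p.1 p.2 ⊆ M) ∧
  (∀ b ∈ M, ∃ p ∈ D, b ∈ stanleySpace p.1 p.2) ∧
  (∀ p ∈ D, ∀ q ∈ D, p ≠ q → Disjoint (stanleySpace p.1 p.2) (stanleySpace q.1 q.2))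

/-- Stanley depth of a set of monomials. -/
def sdepthSet {n : ℕ} (M : Set (Fin n →₀ ℕ)) : ℕ :=
  sSup {k | k ≤ n ∧ ∃ D : Finset ((Fin n →₀ ℕ) × Finset (Fin n)),
    IsStanleyDecomp M D ∧ ∀ p ∈ D, k ≤ p.2.card}

/-- Stanley depth of a monomial ideal `I` (as a module). -/
def sdepthI {K : Type*} [Field K] {n : ℕ} (I : Ideal (MvPolynomial (Fin n) K)) : ℕ :=
  sdepthSet (monomialSet I)

/-- Stanley depth of `S/I` for a monomial ideal `I`. -/
def sdepthQ {K : Type*} [Field K] {n : ℕ} (I : Ideal (MvPolynomial (Fin n) K)) : ℕ :=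
  sdepthSet (monomialSet I)ᶜ

/-- Stanley depth of `I/J` for monomial ideals `J ⊆ I`. -/
def sdepthIJ {K : Type*} [Field K] {n : ℕ} (I J : Ideal (MvPolynomial (Fin n) K)) : ℕ :=
  sdepthSet (monomialSet I \ monomialSet J)

def MonI {K : Type*} [Field K] {n : ℕ} (J : Ideal (MvPolynomial (Fin n) K)) : Prop :=
  ∀ f ∈ J, ∀ d ∈ f.support, (monomial d (1 : K) : MvPolynomial (Fin n) K) ∈ J

section helpers

variable {K : Type*} [Field K] {n : ℕ}

lemma IsMonomialIdeal.monI {I : Ideal (MvPolynomial (Fin n) K)} (h : IsMonomialIdeal I) :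
    MonI I := by
  obtain ⟨A, rfl⟩ := h
  intro f hf d hd
  rw [mem_ideal_span_monomial_image] at hf ⊢
  intro e he
  have : e = d := by
    have := support_monomial_subset he
    simpa using this
  subst this
  exact hf _ hd

lemma IsMonomialIdeal.mul {I J : Ideal (MvPolynomial (Fin n) K)} (h : IsMonomialIdeal I)
    (h' : IsMonomialIdeal J) : IsMonomialIdeal (I * J) := by
  obtain ⟨A, rfl⟩ := h
  obtain ⟨B, rfl⟩ := h'
  refine ⟨{c | ∃ a ∈ A, ∃ b ∈ B, a + b = c}, ?_⟩
  rw [Ideal.span_mul_span']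
  congr 1
  ext x
  simp only [Set.mem_mul, Set.mem_image, Set.mem_setOf_eq]
  constructor
  · rintro ⟨_, ⟨a, ha, rfl⟩, _, ⟨b, hb, rfl⟩, rfl⟩
    exact ⟨a + b, ⟨a, ha, b, hb, rfl⟩, by simp [monomial_mul]⟩
  · rintro ⟨_, ⟨a, ha, b, hb, rfl⟩, rfl⟩
    exact ⟨_, ⟨a, ha, rfl⟩, _, ⟨b, hb, rfl⟩, by simp [monomial_mul]⟩

lemma IsMonomialIdeal.pow {I : Ideal (MvPolynomial (Fin n) K)} (h : IsMonomialIdeal I) (k : ℕ) :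
    IsMonomialIdeal (I ^ k) := by
  induction k with
  | zero =>
    refine ⟨{0}, ?_⟩
    simp
  | succ k ih => rw [pow_succ]; exact ih.mul h

lemma isMonomialIdeal_intCl (I : Ideal (MvPolynomial (Fin n) K)) :
    IsMonomialIdeal (intCl I) := by
  refine ⟨{d | ∃ m : ℕ, 1 ≤ m ∧ (monomial d (1 : K)) ^ m ∈ I ^ m}, ?_⟩
  unfold intCl
  congr 1
  ext x
  constructor
  · rintro ⟨⟨d, rfl⟩, h⟩
    exact ⟨d, h, rfl⟩
  · rintro ⟨d, h, rfl⟩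
    exact ⟨⟨d, rfl⟩, h⟩

lemma mem_intCl_monomial {I : Ideal (MvPolynomial (Fin n) K)} {d : Fin n →₀ ℕ}
    (h : (monomial d (1 : K)) ∈ intCl I) :
    ∃ m : ℕ, 1 ≤ m ∧ (monomial d (1 : K)) ^ m ∈ I ^ m := by
  have : intCl I = Ideal.span ((fun d => (monomial d (1 : K) : MvPolynomial (Fin n) K)) ''
      {d | ∃ m : ℕ, 1 ≤ m ∧ (monomial d (1 : K)) ^ m ∈ I ^ m}) := by
    unfold intCl
    congr 1
    ext x
    constructor
    · rintro ⟨⟨d, rfl⟩, h⟩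
      exact ⟨d, h, rfl⟩
    · rintro ⟨d, h, rfl⟩
      exact ⟨⟨d, rfl⟩, h⟩
  rw [this, mem_ideal_span_monomial_image] at h
  obtain ⟨e, ⟨m, hm, he⟩, hle⟩ := h d (by simp [mem_support_iff])
  refine ⟨m, hm, ?_⟩
  have : (monomial d (1 : K)) = monomial (d - e) 1 * monomial e 1 := by
    rw [monomial_mul, tsub_add_cancel_of_le hle, one_mul]
  rw [this, mul_pow]
  exact Ideal.mul_mem_left _ _ he

lemma monomial_mem_of {J : Ideal (MvPolynomial (Fin n) K)} {d : Fin n →₀ ℕ} (c : K)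
    (h : (monomial d (1 : K)) ∈ J) : monomial d c ∈ J := by
  have : monomial d c = C c * monomial d 1 := by rw [C_mul_monomial, mul_one]
  rw [this]
  exact Ideal.mul_mem_left _ _ h

lemma leadingTerm_erase (m : MonomialOrder (Fin n)) {f : MvPolynomial (Fin n) K} :
    (f - m.leadingTerm f).support = f.support.erase (m.degree f) := by
  ext e
  simp only [mem_support_iff, coeff_sub, MonomialOrder.leadingTerm, coeff_monomial,
    Finset.mem_erase, MonomialOrder.leadingCoeff]
  by_cases h : m.degree f = e
  · subst h; simp
  · simp [h, Ne.symm h]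

lemma lead_pow_mem (m : MonomialOrder (Fin n)) {J : Ideal (MvPolynomial (Fin n) K)} (hJ : MonI J)
    {g : MvPolynomial (Fin n) K} (hg : g ≠ 0) (k : ℕ) :
    ∀ f : MvPolynomial (Fin n) K, f.support.card ≤ k → g * f ∈ J →
      (monomial (m.degree g) (1 : K)) ^ k * f ∈ J := by
  classical
  induction k with
  | zero =>
    intro f hf _
    have : f = 0 := by simpa using hf
    simp [this]
  | succ k ih =>
    intro f hf hgf
    by_cases hf0 : f = 0
    · simp [hf0]
    have h1 : (monomial (m.degree g + m.degree f) (1 : K)) ∈ J := by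
      apply hJ _ hgf
      rw [mem_support_iff, m.coeff_mul_of_degree_add]
      simp [hg, hf0]
    have h2 : monomial (m.degree g) (1 : K) * m.leadingTerm f ∈ J := by
      rw [MonomialOrder.leadingTerm, monomial_mul]
      exact monomial_mem_of _ h1
    have h3 := ih (monomial (m.degree g) (1 : K) * (f - m.leadingTerm f)) (by
      refine (Finset.card_le_card (support_mul _ _)).trans ?_
      refine Finset.card_add_le.trans ?_
      have a1 : (monomial (m.degree g) (1 : K)).support.card ≤ 1 :=
        (Finset.card_le_card support_monomial_subset).trans (by simp)
      have a2 : (f - m.leadingTerm f).support.card ≤ k := by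
        rw [leadingTerm_erase, Finset.card_erase_of_mem (m.degree_mem_support hf0)]
        omega
      nlinarith) (by
      have : g * (monomial (m.degree g) (1 : K) * (f - m.leadingTerm f)) =
        monomial (m.degree g) (1 : K) * (g * f) -
          g * (monomial (m.degree g) (1 : K) * m.leadingTerm f) := by ring
      rw [this]
      exact J.sub_mem (J.mul_mem_left _ hgf) (J.mul_mem_left _ h2))
    have : (monomial (m.degree g) (1 : K)) ^ (k + 1) * f =
        (monomial (m.degree g) (1 : K)) ^ k *
          (monomial (m.degree g) (1 : K) * (f - m.leadingTerm f)) +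
        (monomial (m.degree g) (1 : K)) ^ k *
          (monomial (m.degree g) (1 : K) * m.leadingTerm f) := by ring
    rw [this]
    exact J.add_mem h3 (J.mul_mem_left _ h2)

lemma monI_colon {J P : Ideal (MvPolynomial (Fin n) K)} (hJ : MonI J) (hP : P.IsPrime)
    (f : MvPolynomial (Fin n) K) (hf : ∀ g, g ∈ P ↔ g * f ∈ J) : MonI P := by
  classical
  let m : MonomialOrder (Fin n) := MonomialOrder.lex
  suffices ∀ k : ℕ, ∀ g ∈ P, g.support.card ≤ k → ∀ d ∈ g.support,
      (monomial d (1 : K) : MvPolynomial (Fin n) K) ∈ P from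
    fun g hg d hd => this _ g hg le_rfl d hd
  intro k
  induction k with
  | zero =>
    intro g _ hk d hd
    have : g = 0 := by simpa using hk
    simp [this] at hd
  | succ k ih =>
    intro g hg hk d hd
    have hg0 : g ≠ 0 := by rintro rfl; simp at hd
    have h1 : (monomial (m.degree g) (1 : K)) ∈ P := by
      refine hP.mem_of_pow_mem f.support.card ?_
      rw [hf]
      exact lead_pow_mem m hJ hg0 _ f le_rfl ((hf g).1 hg)
    by_cases h : d = m.degree g
    · rw [h]; exact h1
    refine ih (g - m.leadingTerm g) (P.sub_mem hg (monomial_mem_of _ h1)) ?_ d ?_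
    · rw [leadingTerm_erase, Finset.card_erase_of_mem (m.degree_mem_support hg0)]
      omega
    · rw [leadingTerm_erase]
      exact Finset.mem_erase.2 ⟨h, hd⟩

lemma exists_monomial_colon {J P : Ideal (MvPolynomial (Fin n) K)} (hJ : MonI J) (hP : P.IsPrime)
    (f : MvPolynomial (Fin n) K) (hf : ∀ g, g ∈ P ↔ g * f ∈ J) :
    ∃ d : Fin n →₀ ℕ, ∀ g, g ∈ P ↔ g * monomial d (1 : K) ∈ J := by
  classical
  have hPm := monI_colon hJ hP f hf
  have key : ∀ d ∈ f.support, ∀ g ∈ P, g * monomial d (1 : K) ∈ J := by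
    intro d hd g hg
    rw [g.as_sum, Finset.sum_mul]
    refine J.sum_mem fun a ha => ?_
    rw [monomial_mul]
    apply monomial_mem_of
    refine hJ _ ((hf _).1 (hPm g hg a ha)) _ ?_
    rw [mem_support_iff, coeff_monomial_mul]
    simpa using hd
  by_contra! hcon
  have : ∀ d ∈ f.support, ∃ h, h ∉ P ∧ h * monomial d (1 : K) ∈ J := by
    intro d hd
    obtain ⟨g, hg⟩ := hcon d
    rcases hg with ⟨h1, h2⟩ | ⟨h1, h2⟩
    · exact absurd (key d hd g h1) h2
    · exact ⟨g, h1, h2⟩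
  choose! h h1 h2 using this
  have h3 : ∏ d ∈ f.support, h d ∈ P := by
    rw [hf]
    nth_rewrite 2 [f.as_sum]
    rw [Finset.mul_sum]
    refine J.sum_mem fun a ha => ?_
    rw [← Finset.prod_erase_mul _ _ ha, mul_assoc]
    apply J.mul_mem_left
    have : monomial a (coeff a f) = C (coeff a f) * monomial a 1 := by
      rw [C_mul_monomial, mul_one]
    rw [this, mul_left_comm]
    exact J.mul_mem_left _ (h2 a ha)
  obtain ⟨d, hd, hd'⟩ := (hP.prod_mem_iff).1 h3
  exact h1 d hd hd'

lemma exists_X_mem {P : Ideal (MvPolynomial (Fin n) K)} (hP : P.IsPrime) (d : Fin n →₀ ℕ)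
    (h : monomial d (1 : K) ∈ P) : ∃ i, 1 ≤ d i ∧ (X i : MvPolynomial (Fin n) K) ∈ P := by
  rw [monomial_eq, C_1, one_mul, Finsupp.prod, hP.prod_mem_iff] at h
  obtain ⟨i, hi, h⟩ := h
  exact ⟨i, Nat.one_le_iff_ne_zero.2 (Finsupp.mem_support_iff.1 hi), hP.mem_of_pow_mem _ h⟩

lemma X_dvd_monomial' {d : Fin n →₀ ℕ} {i : Fin n} (c : K) (h : 1 ≤ d i) :
    (X i : MvPolynomial (Fin n) K) ∣ monomial d c := by
  refine ⟨monomial (d - Finsupp.single i 1) c, ?_⟩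
  rw [X, monomial_mul, one_mul, add_tsub_cancel_of_le]
  simpa using h

end helpers

theorem stmt13 {K : Type*} [Field K] {n : ℕ} (I : Ideal (MvPolynomial (Fin n) K))
    (hI : IsMonomialIdeal I) (N₁ N₂ : ℕ) (hN₁ : 1 ≤ N₁) (hN₂ : 1 ≤ N₂)
    (hstab₁ : ∀ k : ℕ, 1 ≤ k →
      associatedPrimes (MvPolynomial (Fin n) K) (MvPolynomial (Fin n) K ⧸ I ^ (N₁ + k)) =
        associatedPrimes (MvPolynomial (Fin n) K) (MvPolynomial (Fin n) K ⧸ I ^ N₁))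
    (hstab₂ : ∀ k : ℕ, 1 ≤ k →
      associatedPrimes (MvPolynomial (Fin n) K) (MvPolynomial (Fin n) K ⧸ intCl (I ^ (N₂ + k))) =
        associatedPrimes (MvPolynomial (Fin n) K) (MvPolynomial (Fin n) K ⧸ intCl (I ^ N₂))) :
    associatedPrimes (MvPolynomial (Fin n) K) (MvPolynomial (Fin n) K ⧸ intCl (I ^ N₂)) ⊆
      associatedPrimes (MvPolynomial (Fin n) K) (MvPolynomial (Fin n) K ⧸ I ^ N₁) := by
  classical
  intro P hPass
  obtain ⟨hP, x, hx⟩ := isAssociatedPrime_iff.1 hPass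
  obtain ⟨f, rfl⟩ := Ideal.Quotient.mk_surjective x
  have hJ := (isMonomialIdeal_intCl (I ^ N₂)).monI
  have hf : ∀ g, g ∈ P ↔ g * f ∈ intCl (I ^ N₂) := by
    intro g
    rw [hx, Submodule.mem_colon_singleton, Submodule.mem_bot, ← Ideal.Quotient.eq_zero_iff_mem]
    rfl
  have hPm := monI_colon hJ hP f hf
  obtain ⟨u, hu⟩ := exists_monomial_colon hJ hP f hf
  have hm : ∀ i : Fin n, ∃ m : ℕ, 1 ≤ m ∧ ((X i : MvPolynomial (Fin n) K) ∈ P →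
      (X i * monomial u (1 : K)) ^ m ∈ (I ^ N₂) ^ m) := by
    intro i
    by_cases hi : (X i : MvPolynomial (Fin n) K) ∈ P
    · have h1 := (hu _).1 hi
      rw [X, monomial_mul, one_mul] at h1
      obtain ⟨m, hm, h2⟩ := mem_intCl_monomial h1
      refine ⟨m, hm, fun _ => ?_⟩
      rw [X, monomial_mul, one_mul]
      exact h2
    · exact ⟨1, le_rfl, fun h => absurd h hi⟩
  choose m hm1 hm2 using hm
  set M : ℕ := (∏ i, m i) * (N₁ + 1) with hM
  have hprod : 1 ≤ ∏ i, m i := Finset.one_le_prod' fun i _ => hm1 i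
  have hMN : N₁ + 1 ≤ M := Nat.le_mul_of_pos_left _ hprod
  have hXM : ∀ i, (X i : MvPolynomial (Fin n) K) ∈ P →
      X i ^ M * monomial u (1 : K) ^ M ∈ (I ^ N₂) ^ M := by
    intro i hi
    obtain ⟨c, hc⟩ : m i ∣ M := (Finset.dvd_prod_of_mem m (Finset.mem_univ i)).mul_right _
    rw [← mul_pow, hc, pow_mul, pow_mul]
    exact Ideal.pow_mem_pow (hm2 i hi) c
  have hMpos : 1 ≤ M := by omega
  have hgt : N₁ + 1 ≤ N₂ * M := hMN.trans (Nat.le_mul_of_pos_left _ hN₂)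
  rw [← hstab₁ (N₂ * M - N₁) (by omega), show N₁ + (N₂ * M - N₁) = N₂ * M by omega]
  refine ⟨hP, Ideal.Quotient.mk _ (monomial u (1 : K) ^ M), ?_⟩
  have hQ : ∀ g, g ∈ (⊥ : Submodule (MvPolynomial (Fin n) K)
      (MvPolynomial (Fin n) K ⧸ I ^ (N₂ * M))).colon
        {Ideal.Quotient.mk _ (monomial u (1 : K) ^ M)} ↔
      g * monomial u (1 : K) ^ M ∈ I ^ (N₂ * M) := by
    intro g
    rw [Submodule.mem_colon_singleton, Submodule.mem_bot, ← Ideal.Quotient.eq_zero_iff_mem]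
    rfl
  apply le_antisymm
  · intro g hg
    rw [g.as_sum]
    refine Ideal.sum_mem _ fun d hd => ?_
    obtain ⟨i, hi, hiP⟩ := exists_X_mem hP d (hPm g hg d hd)
    refine Ideal.mem_of_dvd _ (X_dvd_monomial' _ hi) ⟨M, ?_⟩
    rw [hQ, pow_mul]
    exact hXM i hiP
  · rw [hP.radical_le_iff]
    intro g hg
    rw [hQ] at hg
    rw [g.as_sum]
    refine Ideal.sum_mem _ fun d hd => monomial_mem_of _ ?_
    rw [hu]
    have h1 : monomial (d + M • u) (1 : K) ∈ I ^ (N₂ * M) := by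
      refine (hI.pow _).monI _ hg _ ?_
      rw [monomial_pow, one_pow, mem_support_iff, coeff_mul_monomial, mul_one]
      exact mem_support_iff.1 hd
    refine Ideal.subset_span ⟨⟨d + u, by rw [monomial_mul, one_mul]⟩, M, hMpos, ?_⟩
    rw [← pow_mul]
    obtain ⟨c, hc⟩ : ∃ c, M = c + 1 := ⟨M - 1, by omega⟩
    have h2 : (monomial d (1 : K) * monomial u (1 : K)) ^ M =
        monomial d (1 : K) ^ c * monomial (d + M • u) (1 : K) := by
      have : monomial (d + M • u) (1 : K) = monomial d (1 : K) * monomial u (1 : K) ^ M := by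
        rw [monomial_pow, one_pow, monomial_mul, one_mul]
      rw [this, mul_pow, ← mul_assoc, ← pow_succ, ← hc]
    rw [h2]
    exact Ideal.mul_mem_left _ _ h1
end
end

section
/- Let $I=(x_1^2x_2^2, x_1^2x_3^2, x_2^2x_3^2)\subset S=\mathbb{K}[x_1,x_2,x_3]$ and let $\overline{I}$ be its integral closure. Then for every monomial $u\in\overline{I}$, one has $u^2\in I^2$. -/
open MvPolynomial

noncomputable section

theorem weight_le {K : Type*} [Field K] (I : Ideal (MvPolynomial (Fin 3) K)) (w : Fin 3 → ℕ) (k : ℕ)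
    (hI : I ≤ Ideal.comap (MvPolynomial.aeval (R := K)
      (fun i => (Polynomial.X : Polynomial K) ^ w i)) (Ideal.span {Polynomial.X ^ k}))
    (d : Fin 3 →₀ ℕ) (hd : (monomial d (1 : K) : MvPolynomial (Fin 3) K) ∈ intCl I) :
    k ≤ w 0 * d 0 + w 1 * d 1 + w 2 * d 2 := by
  have key : ∀ e : Fin 3 →₀ ℕ, MvPolynomial.aeval (R := K)
      (fun i => (Polynomial.X : Polynomial K) ^ w i) (monomial e (1 : K)) =
      Polynomial.X ^ (w 0 * e 0 + w 1 * e 1 + w 2 * e 2) := by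
    intro e
    rw [aeval_monomial, Finsupp.prod_fintype _ _ (by simp)]
    simp [Fin.prod_univ_three, ← pow_mul, ← pow_add]
  have hpow : ∀ a b : ℕ, (Polynomial.X : Polynomial K) ^ a ∣ Polynomial.X ^ b → a ≤ b := by
    intro a b h
    exact (pow_dvd_pow_iff Polynomial.X_ne_zero Polynomial.not_isUnit_X).1 h
  have hle : intCl I ≤ Ideal.comap (MvPolynomial.aeval (R := K)
      (fun i => (Polynomial.X : Polynomial K) ^ w i)) (Ideal.span {Polynomial.X ^ k}) := by
    unfold intCl
    rw [Ideal.span_le]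
    rintro u ⟨⟨e, rfl⟩, m, hm, hu⟩
    have h1 := Ideal.le_comap_pow _ m (Ideal.pow_right_mono hI m hu)
    rw [Ideal.mem_comap, map_pow, key, Ideal.span_singleton_pow, Ideal.mem_span_singleton,
      ← pow_mul, ← pow_mul] at h1
    have h2 := hpow _ _ h1
    have h3 := Nat.le_of_mul_le_mul_right h2 hm
    simp only [SetLike.mem_coe, Ideal.mem_comap]
    rw [key, Ideal.mem_span_singleton]
    exact pow_dvd_pow _ h3
  have h := hle hd
  rw [Ideal.mem_comap, key, Ideal.mem_span_singleton] at h
  exact hpow _ _ h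

theorem gens_le {K : Type*} [Field K] (w : Fin 3 → ℕ) (k : ℕ)
    (h1 : k ≤ w 0 * 2 + w 1 * 2) (h2 : k ≤ w 0 * 2 + w 2 * 2) (h3 : k ≤ w 1 * 2 + w 2 * 2) :
    (Ideal.span {X 0 ^ 2 * X 1 ^ 2, X 0 ^ 2 * X 2 ^ 2, X 1 ^ 2 * X 2 ^ 2} :
      Ideal (MvPolynomial (Fin 3) K)) ≤ Ideal.comap (MvPolynomial.aeval (R := K)
      (fun i => (Polynomial.X : Polynomial K) ^ w i)) (Ideal.span {Polynomial.X ^ k}) := by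
  rw [Ideal.span_le]
  rintro u (rfl | rfl | rfl) <;>
  · simp only [SetLike.mem_coe, Ideal.mem_comap, map_mul, map_pow, aeval_X,
      Ideal.mem_span_singleton, ← pow_mul, ← pow_add]
    exact pow_dvd_pow _ (by assumption)

theorem stmt19 {K : Type*} [Field K] :
    ∀ d : Fin 3 →₀ ℕ,
      (monomial d (1 : K) : MvPolynomial (Fin 3) K) ∈
          intCl (Ideal.span {X 0 ^ 2 * X 1 ^ 2, X 0 ^ 2 * X 2 ^ 2, X 1 ^ 2 * X 2 ^ 2}) →
        (monomial d (1 : K) : MvPolynomial (Fin 3) K) ^ 2 ∈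
          (Ideal.span {X 0 ^ 2 * X 1 ^ 2, X 0 ^ 2 * X 2 ^ 2, X 1 ^ 2 * X 2 ^ 2} :
            Ideal (MvPolynomial (Fin 3) K)) ^ 2 := by
  intro d hd
  have a1 := weight_le _ ![1, 1, 1] 4 (gens_le _ _ (by simp) (by simp) (by simp)) d hd
  have a2 := weight_le _ ![1, 1, 0] 2 (gens_le _ _ (by simp) (by simp) (by simp)) d hd
  have a3 := weight_le _ ![1, 0, 1] 2 (gens_le _ _ (by simp) (by simp) (by simp)) d hd
  have a4 := weight_le _ ![0, 1, 1] 2 (gens_le _ _ (by simp) (by simp) (by simp)) d hd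
  simp at a1 a2 a3 a4
  have hm : (monomial d (1 : K) : MvPolynomial (Fin 3) K) = X 0 ^ d 0 * X 1 ^ d 1 * X 2 ^ d 2 := by
    rw [monomial_eq, Finsupp.prod_fintype _ _ (by simp)]
    simp [Fin.prod_univ_three]
  rw [hm]
  generalize d 0 = a at *
  generalize d 1 = b at *
  generalize d 2 = c at *
  set I : Ideal (MvPolynomial (Fin 3) K) :=
    Ideal.span {X 0 ^ 2 * X 1 ^ 2, X 0 ^ 2 * X 2 ^ 2, X 1 ^ 2 * X 2 ^ 2} with hI
  have g1 : (X 0 ^ 2 * X 1 ^ 2 : MvPolynomial (Fin 3) K) ∈ I := Ideal.subset_span (by simp)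
  have g2 : (X 0 ^ 2 * X 2 ^ 2 : MvPolynomial (Fin 3) K) ∈ I := Ideal.subset_span (by simp)
  have g3 : (X 1 ^ 2 * X 2 ^ 2 : MvPolynomial (Fin 3) K) ∈ I := Ideal.subset_span (by simp)
  have main : ∀ p q r : ℕ, p ≤ a → q ≤ b → r ≤ c →
      ((X 0 ^ p * X 1 ^ q * X 2 ^ r : MvPolynomial (Fin 3) K) ^ 2 ∈ I ^ 2) →
      (X 0 ^ a * X 1 ^ b * X 2 ^ c : MvPolynomial (Fin 3) K) ^ 2 ∈ I ^ 2 := by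
    intro p q r hp hq hr h
    exact Ideal.mem_of_dvd _ (pow_dvd_pow_of_dvd (mul_dvd_mul (mul_dvd_mul (pow_dvd_pow _ hp)
      (pow_dvd_pow _ hq)) (pow_dvd_pow _ hr)) 2) h
  have hc : (2 ≤ a ∧ 2 ≤ b ∧ 0 ≤ c) ∨ (2 ≤ a ∧ 0 ≤ b ∧ 2 ≤ c) ∨ (0 ≤ a ∧ 2 ≤ b ∧ 2 ≤ c) ∨
      (2 ≤ a ∧ 1 ≤ b ∧ 1 ≤ c) ∨ (1 ≤ a ∧ 2 ≤ b ∧ 1 ≤ c) ∨ (1 ≤ a ∧ 1 ≤ b ∧ 2 ≤ c) := by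
    omega
  rcases hc with ⟨x, y, z⟩ | ⟨x, y, z⟩ | ⟨x, y, z⟩ | ⟨x, y, z⟩ | ⟨x, y, z⟩ | ⟨x, y, z⟩ <;>
    refine main _ _ _ x y z ?_ <;> rw [pow_two I]
  · convert Ideal.mul_mem_mul g1 g1 using 1; ring
  · convert Ideal.mul_mem_mul g2 g2 using 1; ring
  · convert Ideal.mul_mem_mul g3 g3 using 1; ring
  · convert Ideal.mul_mem_mul g1 g2 using 1; ring
  · convert Ideal.mul_mem_mul g1 g3 using 1; ring
  · convert Ideal.mul_mem_mul g2 g3 using 1; ring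
end
end
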